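/- arXiv:1803.00789 — 2 statements merged into one kernel-verified Lean document; each statement's English description precedes it below -/
import Mathlib

section
/- Let α ∈ [0,∞)^d and f ∈ C_c^∞(ℝ_+^d). Then for every i = 1,…,d, every t > 0 and every fixed x̂^i = (x_1,…,x_{i−1},x_{i+1},…,x_d) ∈ ℝ_+^{d−1}, the partial derivative of the Poisson integral in the i-th variable tends to zero at the boundary: lim_{x_i→0^+} ∂_{x_i} P_t^α f(x_i, x̂^i) = 0. -/
open MeasureTheory Real Filter Set
open scoped ENNReal BigOperators

noncomputable section

/-- The open positive orthant `(0,∞)^d`. -/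
def posOrth (d : ℕ) : Set (Fin d → ℝ) := {x | ∀ j, 0 < x j}

/-- The weighted measure `x^{2α} dx` on the positive orthant. -/
def wMeasure (d : ℕ) (α : Fin d → ℝ) : Measure (Fin d → ℝ) :=
  (volume.restrict (posOrth d)).withDensity
    (fun x => ENNReal.ofReal (∏ j, (x j) ^ (2 * α j)))

/-- The Bessel function of the first kind of order `μ`. -/
def besselJ (μ : ℝ) (z : ℝ) : ℝ :=
  ∑' k : ℕ, ((-1 : ℝ) ^ k / ((k.factorial : ℝ) * Real.Gamma ((k : ℝ) + μ + 1))) *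
    (z / 2) ^ (2 * (k : ℝ) + μ)

/-- The modified Bessel function of the first kind of order `μ`. -/
def besselI (μ : ℝ) (z : ℝ) : ℝ :=
  ∑' k : ℕ, (1 / ((k.factorial : ℝ) * Real.Gamma ((k : ℝ) + μ + 1))) *
    (z / 2) ^ (2 * (k : ℝ) + μ)

/-- The eigenfunctions `φ_y^α(x) = ∏_j (x_j y_j)^{-α_j+1/2} J_{α_j-1/2}(x_j y_j)`. -/
def phiFn (d : ℕ) (α : Fin d → ℝ) (y x : Fin d → ℝ) : ℝ :=
  ∏ j, ((x j * y j) ^ (-(α j) + 1 / 2) * besselJ (α j - 1 / 2) (x j * y j))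

/-- The Hankel transform `h_α f(x) = ∫ φ_y^α(x) f(y) y^{2α} dy`. -/
def hankel (d : ℕ) (α : Fin d → ℝ) (f : (Fin d → ℝ) → ℝ) (x : Fin d → ℝ) : ℝ :=
  ∫ y, phiFn d α y x * f y ∂(wMeasure d α)

/-- The Euclidean norm on `Fin d → ℝ`. -/
def eNorm (d : ℕ) (x : Fin d → ℝ) : ℝ := Real.sqrt (∑ j, (x j) ^ 2)

/-- The `i`-th Bessel–Riesz transform
`R_{α,i} f(x) = -x_i h_{α+e_i}((1/|y|) h_α f(y))(x)`. -/
def riesz (d : ℕ) (α : Fin d → ℝ) (i : Fin d) (f : (Fin d → ℝ) → ℝ)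
    (x : Fin d → ℝ) : ℝ :=
  -(x i) * hankel d (α + Pi.single i 1) (fun y => (1 / eNorm d y) * hankel d α f y) x

/-- The Bessel–Poisson semigroup `P_t^α f = h_α(e^{-|·|t} h_α f)`. -/
def poissonH (d : ℕ) (α : Fin d → ℝ) (t : ℝ) (f : (Fin d → ℝ) → ℝ) :
    (Fin d → ℝ) → ℝ :=
  hankel d α (fun y => Real.exp (-(eNorm d y) * t) * hankel d α f y)

/-- The `i`-th conjugate Poisson semigroup
`ℙ_t^{α,i} g(x) = x_i h_{α+e_i}(e^{-|y|t} h_{α+e_i}(g(·)/·_i)(y))(x)`. -/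
def conjPoissonH (d : ℕ) (α : Fin d → ℝ) (i : Fin d) (t : ℝ)
    (g : (Fin d → ℝ) → ℝ) (x : Fin d → ℝ) : ℝ :=
  x i * hankel d (α + Pi.single i 1)
    (fun y => Real.exp (-(eNorm d y) * t) *
      hankel d (α + Pi.single i 1) (fun z => g z / z i) y) x

/-- The Bessel heat kernel `𝒲_t^α(x,y)`. -/
def heatK (d : ℕ) (α : Fin d → ℝ) (t : ℝ) (x y : Fin d → ℝ) : ℝ :=
  (2 * t) ^ (-(∑ j, α j) - (d : ℝ) / 2) *
    Real.exp (-((eNorm d x) ^ 2 + (eNorm d y) ^ 2) / (4 * t)) *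
    ∏ j, ((x j * y j / (2 * t)) ^ (-(α j) + 1 / 2) *
      besselI (α j - 1 / 2) (x j * y j / (2 * t)))

/-- The Bessel–Poisson kernel `𝒫_t^α(x,y)` obtained by subordination. -/
def poissonK (d : ℕ) (α : Fin d → ℝ) (t : ℝ) (x y : Fin d → ℝ) : ℝ :=
  (t / Real.sqrt (2 * Real.pi)) *
    ∫ u in Set.Ioi (0 : ℝ),
      u ^ (-(3 : ℝ) / 2) * Real.exp (-(t ^ 2) / (4 * u)) * heatK d α u x y

/-- The Poisson semigroup defined through the Poisson kernel. -/
def poissonOp (d : ℕ) (α : Fin d → ℝ) (t : ℝ) (f : (Fin d → ℝ) → ℝ)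
    (x : Fin d → ℝ) : ℝ :=
  ∫ y, poissonK d α t x y * f y ∂(wMeasure d α)

/-- The partial derivative in the `i`-th coordinate. -/
def pd (d : ℕ) (i : Fin d) (F : (Fin d → ℝ) → ℝ) (x : Fin d → ℝ) : ℝ :=
  deriv (fun s => F (Function.update x i s)) (x i)

/-- Smooth compactly supported functions on `(0,∞)^d`. -/
def CcInfPos (d : ℕ) (f : (Fin d → ℝ) → ℝ) : Prop :=
  ContDiff ℝ (⊤ : ℕ∞) f ∧ HasCompactSupport f ∧ tsupport f ⊆ posOrth d

/-- The `k`-th Taylor coefficient of `z ↦ z^{-μ} I_μ(z)` in the variable `z²`. -/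
def besselCoeff (μ : ℝ) (k : ℕ) : ℝ :=
  1 / ((k.factorial : ℝ) * Real.Gamma ((k : ℝ) + μ + 1)) * (1 / 2) ^ (2 * (k : ℝ) + μ)

/-- The entire even function `z ↦ z^{-μ} I_μ(z)`. -/
def besselPhi (μ z : ℝ) : ℝ := ∑' k : ℕ, besselCoeff μ k * z ^ (2 * k)

/-- The one-dimensional factor of the Bessel heat kernel. -/
def heatFactor (a u x y : ℝ) : ℝ :=
  Real.exp (-(x ^ 2 + y ^ 2) / (4 * u)) * besselPhi (a - 1 / 2) (x * y / (2 * u))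

theorem rpow_mul_besselI (a : ℝ) {z : ℝ} (hz : 0 < z) :
    z ^ (-a + 1 / 2) * besselI (a - 1 / 2) z = besselPhi (a - 1 / 2) z := by
  unfold besselI besselPhi
  rw [← tsum_mul_left]
  refine tsum_congr fun k => ?_
  have h : z ^ (2 * k) = z ^ (-a + 1 / 2) * z ^ (2 * (k : ℝ) + (a - 1 / 2)) := by
    rw [← Real.rpow_add hz, ← Real.rpow_natCast]
    congr 1
    push_cast
    ring
  rw [h, besselCoeff, div_eq_mul_one_div z 2, Real.mul_rpow hz.le (by norm_num)]
  ring

theorem besselCoeff_nonneg {μ : ℝ} (hμ : -1 / 2 ≤ μ) (k : ℕ) : 0 ≤ besselCoeff μ k := by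
  have : 0 < Real.Gamma ((k : ℝ) + μ + 1) :=
    Real.Gamma_pos_of_pos (by linarith [(Nat.cast_nonneg k : (0 : ℝ) ≤ k)])
  unfold besselCoeff
  positivity

theorem besselCoeff_succ {μ : ℝ} (hμ : -1 / 2 ≤ μ) (k : ℕ) :
    besselCoeff μ (k + 1) = besselCoeff μ k / (4 * (k + 1) * (k + μ + 1)) := by
  have hk : (0 : ℝ) < k + μ + 1 := by linarith [(Nat.cast_nonneg k : (0 : ℝ) ≤ k)]
  have hG := Real.Gamma_pos_of_pos hk
  have h1 : Real.Gamma (((k + 1 : ℕ) : ℝ) + μ + 1) = (k + μ + 1) * Real.Gamma (k + μ + 1) := by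
    rw [← Real.Gamma_add_one hk.ne']
    congr 1
    push_cast
    ring
  have h2 : (1 / 2 : ℝ) ^ (2 * ((k + 1 : ℕ) : ℝ) + μ) =
      (1 / 2 : ℝ) ^ (2 * (k : ℝ) + μ) * (1 / 4) := by
    rw [show 2 * ((k + 1 : ℕ) : ℝ) + μ = (2 * (k : ℝ) + μ) + 2 by push_cast; ring,
      Real.rpow_add (by norm_num)]
    norm_num
  rw [besselCoeff, besselCoeff, h1, h2, Nat.factorial_succ]
  have : (k.factorial : ℝ) ≠ 0 := by positivity
  push_cast
  field_simp

theorem besselCoeff_le {μ : ℝ} (hμ : -1 / 2 ≤ μ) (k : ℕ) :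
    besselCoeff μ k ≤ besselCoeff μ 0 / ((2 * k).factorial : ℝ) := by
  induction k with
  | zero => simp
  | succ k ih =>
    have hk : (0 : ℝ) ≤ k := Nat.cast_nonneg k
    have h1 : (((2 * (k + 1)).factorial : ℕ) : ℝ) =
        ((2 * k).factorial : ℝ) * (4 * (k + 1) * (k + 1 / 2)) := by
      rw [show 2 * (k + 1) = 2 * k + 1 + 1 by ring, Nat.factorial_succ, Nat.factorial_succ]
      push_cast
      ring
    have h0 := besselCoeff_nonneg hμ 0
    rw [besselCoeff_succ hμ, h1, ← div_div (besselCoeff μ 0)]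
    refine div_le_div₀ (by positivity) ih (by positivity) ?_
    exact mul_le_mul_of_nonneg_left (by linarith) (by positivity)

theorem hasSum_besselBound (μ z : ℝ) :
    HasSum (fun k : ℕ => besselCoeff μ 0 * (z ^ (2 * k) / ((2 * k).factorial : ℝ)))
      (besselCoeff μ 0 * Real.cosh z) :=
  (Real.hasSum_cosh z).mul_left _

theorem summable_besselPhi {μ : ℝ} (hμ : -1 / 2 ≤ μ) (z : ℝ) :
    Summable fun k : ℕ => besselCoeff μ k * z ^ (2 * k) := by
  refine (hasSum_besselBound μ z).summable.of_nonneg_of_le (fun k => ?_) fun k => ?_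
  · have := besselCoeff_nonneg hμ k
    rw [pow_mul]
    positivity
  · rw [mul_div_left_comm, mul_comm]
    exact mul_le_mul_of_nonneg_left (besselCoeff_le hμ k) (by rw [pow_mul]; positivity)

theorem cosh_le_exp {z : ℝ} (hz : 0 ≤ z) : Real.cosh z ≤ Real.exp z := by
  rw [Real.cosh_eq]
  linarith [Real.exp_le_exp.2 (show -z ≤ z by linarith)]

theorem besselPhi_nonneg {μ : ℝ} (hμ : -1 / 2 ≤ μ) (z : ℝ) : 0 ≤ besselPhi μ z :=
  tsum_nonneg fun k => by
    have := besselCoeff_nonneg hμ k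
    rw [pow_mul]
    positivity

theorem besselPhi_le {μ z : ℝ} (hμ : -1 / 2 ≤ μ) (hz : 0 ≤ z) :
    besselPhi μ z ≤ besselCoeff μ 0 * Real.exp z := by
  have h0 := besselCoeff_nonneg hμ 0
  calc besselPhi μ z ≤ besselCoeff μ 0 * Real.cosh z := by
        rw [← (hasSum_besselBound μ z).tsum_eq]
        refine (summable_besselPhi hμ z).tsum_le_tsum (fun k => ?_)
          (hasSum_besselBound μ z).summable
        rw [mul_div_left_comm, mul_comm]
        exact mul_le_mul_of_nonneg_left (besselCoeff_le hμ k) (by rw [pow_mul]; positivity)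
    _ ≤ _ := by gcongr; exact cosh_le_exp hz

theorem pow_succ_sub_pow_succ_le {a b : ℝ} (hb : 0 ≤ b) (hab : b ≤ a) (n : ℕ) :
    a ^ (n + 1) - b ^ (n + 1) ≤ (n + 1) * a ^ n * (a - b) := by
  induction n with
  | zero => simp
  | succ n ih =>
    have ha := hb.trans hab
    have h1 := mul_le_mul_of_nonneg_left ih ha
    have h2 : (a - b) * b ^ (n + 1) ≤ (a - b) * a ^ (n + 1) := by
      have := sub_nonneg.2 hab
      gcongr
    push_cast
    calc a ^ (n + 1 + 1) - b ^ (n + 1 + 1)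
        = a * (a ^ (n + 1) - b ^ (n + 1)) + (a - b) * b ^ (n + 1) := by ring
      _ ≤ a * ((n + 1) * a ^ n * (a - b)) + (a - b) * a ^ (n + 1) := add_le_add h1 h2
      _ = _ := by ring

theorem abs_besselPhi_sub_le {μ z w : ℝ} (hμ : -1 / 2 ≤ μ) (hw : 0 ≤ w) (hwz : w ≤ z) :
    |besselPhi μ z - besselPhi μ w| ≤ besselCoeff μ 0 * Real.exp z * (z ^ 2 - w ^ 2) := by
  have hz := hw.trans hwz
  have h0 := besselCoeff_nonneg hμ 0
  have hsq : w ^ 2 ≤ z ^ 2 := by gcongr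
  have hS := (summable_besselPhi hμ z).sub (summable_besselPhi hμ w)
  have hterm : ∀ k : ℕ, besselCoeff μ (k + 1) * z ^ (2 * (k + 1)) -
      besselCoeff μ (k + 1) * w ^ (2 * (k + 1)) ≤
      besselCoeff μ 0 * (z ^ (2 * k) / ((2 * k).factorial : ℝ)) * (z ^ 2 - w ^ 2) := by
    intro k
    have hk : (0 : ℝ) ≤ k := Nat.cast_nonneg k
    have hc : besselCoeff μ (k + 1) * (k + 1) ≤ besselCoeff μ 0 / ((2 * k).factorial : ℝ) := by
      refine le_trans ?_ (besselCoeff_le hμ k)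
      rw [besselCoeff_succ hμ, div_mul_eq_mul_div, div_le_iff₀ (by nlinarith)]
      exact mul_le_mul_of_nonneg_left (by nlinarith) (besselCoeff_nonneg hμ k)
    have hp := pow_succ_sub_pow_succ_le (sq_nonneg w) hsq k
    rw [pow_mul, pow_mul w, ← mul_sub]
    calc _ ≤ besselCoeff μ (k + 1) * ((k + 1) * (z ^ 2) ^ k * (z ^ 2 - w ^ 2)) :=
          mul_le_mul_of_nonneg_left hp (besselCoeff_nonneg hμ _)
      _ = besselCoeff μ (k + 1) * (k + 1) * (z ^ 2) ^ k * (z ^ 2 - w ^ 2) := by ring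
      _ ≤ besselCoeff μ 0 / ((2 * k).factorial : ℝ) * (z ^ 2) ^ k * (z ^ 2 - w ^ 2) := by
          have := sub_nonneg.2 hsq
          gcongr
      _ = _ := by rw [pow_mul]; ring
  have hB := (hasSum_besselBound μ z).mul_right (z ^ 2 - w ^ 2)
  have hnn : 0 ≤ besselPhi μ z - besselPhi μ w := by
    refine sub_nonneg.2 ((summable_besselPhi hμ w).tsum_le_tsum (fun k => ?_)
      (summable_besselPhi hμ z))
    have := besselCoeff_nonneg hμ k
    gcongr
  rw [abs_of_nonneg hnn]
  calc besselPhi μ z - besselPhi μ w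
      = ∑' k : ℕ, (besselCoeff μ k * z ^ (2 * k) - besselCoeff μ k * w ^ (2 * k)) :=
        ((summable_besselPhi hμ z).tsum_sub (summable_besselPhi hμ w)).symm
    _ = ∑' k : ℕ, (besselCoeff μ (k + 1) * z ^ (2 * (k + 1)) -
          besselCoeff μ (k + 1) * w ^ (2 * (k + 1))) := by
        rw [hS.tsum_eq_zero_add]
        simp
    _ ≤ besselCoeff μ 0 * Real.cosh z * (z ^ 2 - w ^ 2) := by
        rw [← hB.tsum_eq]
        exact ((summable_nat_add_iff 1).2 hS).tsum_le_tsum hterm hB.summable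
    _ ≤ _ := by
        have := sub_nonneg.2 hsq
        gcongr
        exact cosh_le_exp hz

theorem measurable_besselPhi {μ : ℝ} (hμ : -1 / 2 ≤ μ) : Measurable (besselPhi μ) := by
  refine measurable_of_tendsto_metrizable
    (f := fun n z => ∑ k ∈ Finset.range n, besselCoeff μ k * z ^ (2 * k)) (fun n => ?_)
    (tendsto_pi_nhds.2 fun z => (summable_besselPhi hμ z).hasSum.tendsto_sum_nat)
  fun_prop

theorem exp_neg_mul_exp (u x y : ℝ) (hu : 0 < u) :
    Real.exp (-(x ^ 2 + y ^ 2) / (4 * u)) * Real.exp (x * y / (2 * u)) ≤ 1 := by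
  rw [← Real.exp_add, Real.exp_le_one_iff]
  have : -(x ^ 2 + y ^ 2) / (4 * u) + x * y / (2 * u) = -((x - y) ^ 2 / (4 * u)) := by
    field_simp
    ring
  rw [this, neg_nonpos]
  positivity

theorem heatFactor_nonneg {a : ℝ} (ha : 0 ≤ a) (u x y : ℝ) : 0 ≤ heatFactor a u x y :=
  mul_nonneg (Real.exp_nonneg _) (besselPhi_nonneg (by linarith) _)

theorem heatFactor_le {a u x y : ℝ} (ha : 0 ≤ a) (hu : 0 < u) (hx : 0 ≤ x) (hy : 0 ≤ y) :
    heatFactor a u x y ≤ besselCoeff (a - 1 / 2) 0 := by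
  have hμ : -1 / 2 ≤ a - 1 / 2 := by linarith
  have h0 := besselCoeff_nonneg hμ 0
  have h := exp_neg_mul_exp u x y hu
  calc heatFactor a u x y
      ≤ Real.exp (-(x ^ 2 + y ^ 2) / (4 * u)) *
          (besselCoeff (a - 1 / 2) 0 * Real.exp (x * y / (2 * u))) :=
        mul_le_mul_of_nonneg_left (besselPhi_le hμ (by positivity)) (Real.exp_nonneg _)
    _ = besselCoeff (a - 1 / 2) 0 *
          (Real.exp (-(x ^ 2 + y ^ 2) / (4 * u)) * Real.exp (x * y / (2 * u))) := by ring
    _ ≤ _ := mul_le_of_le_one_right h0 h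

theorem abs_heatFactor_sub_le {a u y r s : ℝ} (ha : 0 ≤ a) (hu : 0 < u) (hy : 0 ≤ y)
    (hr : 0 ≤ r) (hs : 0 ≤ s) :
    |heatFactor a u r y - heatFactor a u s y| ≤
      besselCoeff (a - 1 / 2) 0 * |r ^ 2 - s ^ 2| * (1 / (4 * u) + y ^ 2 / (4 * u ^ 2)) := by
  wlog hsr : s ≤ r generalizing r s
  · rw [abs_sub_comm, abs_sub_comm (r ^ 2)]
    exact this hs hr (le_of_not_ge hsr)
  have hμ : -1 / 2 ≤ a - 1 / 2 := by linarith
  set c := besselCoeff (a - 1 / 2) 0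
  have h0 : 0 ≤ c := besselCoeff_nonneg hμ 0
  have hsq : 0 ≤ r ^ 2 - s ^ 2 := sub_nonneg.2 (by gcongr)
  rw [abs_of_nonneg hsq]
  set E := Real.exp (-(r ^ 2 + y ^ 2) / (4 * u)) with hE
  set E' := Real.exp (-(s ^ 2 + y ^ 2) / (4 * u)) with hE'
  have h1 : |E * (besselPhi (a - 1 / 2) (r * y / (2 * u)) -
      besselPhi (a - 1 / 2) (s * y / (2 * u)))| ≤
      c * (r ^ 2 - s ^ 2) * (y ^ 2 / (4 * u ^ 2)) := by
    rw [abs_mul, abs_of_nonneg (Real.exp_nonneg _)]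
    have hb := abs_besselPhi_sub_le (μ := a - 1 / 2) (z := r * y / (2 * u))
      (w := s * y / (2 * u)) hμ (by positivity) (by gcongr)
    have he := exp_neg_mul_exp u r y hu
    calc _ ≤ E * (c * Real.exp (r * y / (2 * u)) *
            ((r * y / (2 * u)) ^ 2 - (s * y / (2 * u)) ^ 2)) :=
          mul_le_mul_of_nonneg_left hb (Real.exp_nonneg _)
      _ = (E * Real.exp (r * y / (2 * u))) * (c * (r ^ 2 - s ^ 2) * (y ^ 2 / (4 * u ^ 2))) := by
          field_simp
          ring
      _ ≤ _ := mul_le_of_le_one_left (by positivity) he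
  have h2 : |(E - E') * besselPhi (a - 1 / 2) (s * y / (2 * u))| ≤
      c * (r ^ 2 - s ^ 2) * (1 / (4 * u)) := by
    have hEE : E = E' * Real.exp (-((r ^ 2 - s ^ 2) / (4 * u))) := by
      rw [hE, hE', ← Real.exp_add]
      congr 1
      ring
    have hd : |E - E'| ≤ E' * ((r ^ 2 - s ^ 2) / (4 * u)) := by
      have hle : Real.exp (-((r ^ 2 - s ^ 2) / (4 * u))) ≤ 1 := by
        rw [Real.exp_le_one_iff, neg_nonpos]
        positivity
      rw [hEE, abs_sub_comm, show ∀ p q : ℝ, p - p * q = p * (1 - q) by intros; ring, abs_mul,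
        abs_of_nonneg (Real.exp_nonneg _), abs_of_nonneg (by linarith)]
      refine mul_le_mul_of_nonneg_left ?_ (Real.exp_nonneg _)
      linarith [Real.add_one_le_exp (-((r ^ 2 - s ^ 2) / (4 * u)))]
    have hf := heatFactor_le ha hu hs hy
    have hp := besselPhi_nonneg hμ (s * y / (2 * u))
    rw [abs_mul, abs_of_nonneg hp]
    calc _ ≤ E' * ((r ^ 2 - s ^ 2) / (4 * u)) * besselPhi (a - 1 / 2) (s * y / (2 * u)) :=
          mul_le_mul_of_nonneg_right hd hp
      _ = ((r ^ 2 - s ^ 2) / (4 * u)) * heatFactor a u s y := by rw [heatFactor]; ring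
      _ ≤ ((r ^ 2 - s ^ 2) / (4 * u)) * c := mul_le_mul_of_nonneg_left hf (by positivity)
      _ = _ := by ring
  have hsplit : heatFactor a u r y - heatFactor a u s y =
      E * (besselPhi (a - 1 / 2) (r * y / (2 * u)) - besselPhi (a - 1 / 2) (s * y / (2 * u))) +
      (E - E') * besselPhi (a - 1 / 2) (s * y / (2 * u)) := by
    rw [heatFactor, heatFactor]
    ring
  rw [hsplit]
  refine (abs_add_le _ _).trans ?_
  linarith

/-- The Bessel heat kernel written through the entire functions `besselPhi`. -/
def heatProd (d : ℕ) (α : Fin d → ℝ) (u : ℝ) (x y : Fin d → ℝ) : ℝ :=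
  (2 * u) ^ (-(∑ j, α j) - (d : ℝ) / 2) * ∏ j, heatFactor (α j) u (x j) (y j)

theorem heatK_eq_heatProd {d : ℕ} (α : Fin d → ℝ) {u : ℝ} (hu : 0 < u) {x y : Fin d → ℝ}
    (hx : x ∈ posOrth d) (hy : y ∈ posOrth d) : heatK d α u x y = heatProd d α u x y := by
  have hE : Real.exp (-((eNorm d x) ^ 2 + (eNorm d y) ^ 2) / (4 * u)) =
      ∏ j, Real.exp (-((x j) ^ 2 + (y j) ^ 2) / (4 * u)) := by
    rw [← Real.exp_sum, eNorm, eNorm, Real.sq_sqrt (by positivity), Real.sq_sqrt (by positivity),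
      ← Finset.sum_add_distrib, ← Finset.sum_neg_distrib, Finset.sum_div]
  rw [heatK, heatProd, hE, mul_assoc, ← Finset.prod_mul_distrib]
  congr 1
  refine Finset.prod_congr rfl fun j _ => ?_
  have := hx j
  have := hy j
  rw [rpow_mul_besselI _ (by positivity), heatFactor]

theorem abs_heatProd_update_sub_le {d : ℕ} {α : Fin d → ℝ} (hα : ∀ j, 0 ≤ α j) {u : ℝ}
    (hu : 0 < u) (i : Fin d) {x y : Fin d → ℝ} (hx : ∀ j, j ≠ i → 0 < x j)
    (hy : y ∈ posOrth d) {r s : ℝ} (hr : 0 < r) (hs : 0 < s) :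
    |heatProd d α u (Function.update x i r) y - heatProd d α u (Function.update x i s) y| ≤
      (∏ j, besselCoeff (α j - 1 / 2) 0) * |r ^ 2 - s ^ 2| * (1 + y i ^ 2) *
        ((2 * u) ^ (-(∑ j, α j) - (d : ℝ) / 2) * (1 / (4 * u) + 1 / (4 * u ^ 2))) := by
  have hprod : ∀ q : ℝ, heatProd d α u (Function.update x i q) y =
      (2 * u) ^ (-(∑ j, α j) - (d : ℝ) / 2) * (heatFactor (α i) u q (y i) *
        ∏ j ∈ Finset.univ.erase i, heatFactor (α j) u (x j) (y j)) := by
    intro q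
    rw [heatProd, ← Finset.mul_prod_erase _ _ (Finset.mem_univ i), Function.update_self]
    congr 2
    refine Finset.prod_congr rfl fun j hj => ?_
    rw [Function.update_of_ne (Finset.ne_of_mem_erase hj)]
  have hnn : 0 ≤ ∏ j ∈ Finset.univ.erase i, heatFactor (α j) u (x j) (y j) :=
    Finset.prod_nonneg fun j _ => heatFactor_nonneg (hα j) _ _ _
  have hle : ∏ j ∈ Finset.univ.erase i, heatFactor (α j) u (x j) (y j) ≤
      ∏ j ∈ Finset.univ.erase i, besselCoeff (α j - 1 / 2) 0 :=
    Finset.prod_le_prod (fun j _ => heatFactor_nonneg (hα j) _ _ _) fun j hj =>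
      heatFactor_le (hα j) hu (hx j (Finset.ne_of_mem_erase hj)).le (hy j).le
  have hi := abs_heatFactor_sub_le (hα i) hu (hy i).le hr.le hs.le
  have h0 : 0 ≤ besselCoeff (α i - 1 / 2) 0 := besselCoeff_nonneg (by linarith [hα i]) 0
  have hw : 1 / (4 * u) + y i ^ 2 / (4 * u ^ 2) ≤
      (1 + y i ^ 2) * (1 / (4 * u) + 1 / (4 * u ^ 2)) := by
    have h1 : 0 ≤ y i ^ 2 * (1 / (4 * u)) := by positivity
    have h2 : 0 ≤ 1 / (4 * u ^ 2) := by positivity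
    calc _ ≤ 1 / (4 * u) + y i ^ 2 / (4 * u ^ 2) + (y i ^ 2 * (1 / (4 * u)) + 1 / (4 * u ^ 2)) :=
          le_add_of_nonneg_right (add_nonneg h1 h2)
      _ = _ := by ring
  have hpow : 0 ≤ (2 * u) ^ (-(∑ j, α j) - (d : ℝ) / 2) := by positivity
  rw [hprod, hprod, ← mul_sub, ← sub_mul, abs_mul, abs_mul, abs_of_nonneg hpow, abs_of_nonneg hnn,
    ← Finset.mul_prod_erase _ (fun j => besselCoeff (α j - 1 / 2) 0) (Finset.mem_univ i)]
  calc _ ≤ (2 * u) ^ (-(∑ j, α j) - (d : ℝ) / 2) *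
        ((besselCoeff (α i - 1 / 2) 0 * |r ^ 2 - s ^ 2| *
          ((1 + y i ^ 2) * (1 / (4 * u) + 1 / (4 * u ^ 2)))) *
          ∏ j ∈ Finset.univ.erase i, besselCoeff (α j - 1 / 2) 0) := by
        refine mul_le_mul_of_nonneg_left (mul_le_mul (hi.trans ?_) hle hnn ?_) hpow
        · exact mul_le_mul_of_nonneg_left hw (by positivity)
        · positivity
    _ = _ := by ring

theorem measurable_heatFactor {a : ℝ} (ha : 0 ≤ a) (x : ℝ) :
    Measurable fun p : ℝ × ℝ => heatFactor a p.1 x p.2 := by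
  have h := measurable_besselPhi (μ := a - 1 / 2) (by linarith)
  unfold heatFactor
  fun_prop

theorem measurable_heatProd {d : ℕ} {α : Fin d → ℝ} (hα : ∀ j, 0 ≤ α j) (x : Fin d → ℝ) :
    Measurable fun p : (Fin d → ℝ) × ℝ => heatProd d α p.2 x p.1 := by
  unfold heatProd
  refine Measurable.mul (by fun_prop) (Finset.measurable_fun_prod _ fun j _ => ?_)
  exact (measurable_heatFactor (hα j) (x j)).comp
    (f := fun p : (Fin d → ℝ) × ℝ => (p.2, p.1 j)) (by fun_prop)

theorem integrableOn_rpow_mul_exp_neg_div {c p : ℝ} (hc : 0 < c) (hp : p < -1) :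
    IntegrableOn (fun u : ℝ => u ^ p * Real.exp (-c / u)) (Ioi 0) := by
  have h := (integrableOn_Ioi_comp_rpow_iff'
    (fun v : ℝ => v ^ (-2 - p) * Real.exp (-c * v ^ (1 : ℝ))) (p := -1) (by norm_num)).2
    (integrableOn_rpow_mul_exp_neg_mul_rpow (by linarith) one_pos hc)
  refine h.congr_fun (fun u hu => ?_) measurableSet_Ioi
  have hu : 0 < u := hu
  simp only [smul_eq_mul, Real.rpow_one]
  rw [← Real.rpow_mul hu.le, ← mul_assoc, ← Real.rpow_add hu, Real.rpow_neg_one, div_eq_mul_inv]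
  congr 2
  ring

/-- Up to a constant, the integral of this weight dominates the difference quotients in `x_i²`
of the Poisson kernel. -/
theorem integrableOn_subordinationWeight {t B : ℝ} (ht : 0 < t) (hB : B ≤ 0) :
    IntegrableOn (fun u : ℝ => u ^ (-(3 : ℝ) / 2) * Real.exp (-(t ^ 2) / (4 * u)) *
      ((2 * u) ^ B * (1 / (4 * u) + 1 / (4 * u ^ 2)))) (Ioi 0) := by
  have hc : 0 < t ^ 2 / 4 := by positivity
  have h1 := integrableOn_rpow_mul_exp_neg_div hc (p := -(3 : ℝ) / 2 + B - 1) (by linarith)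
  have h2 := integrableOn_rpow_mul_exp_neg_div hc (p := -(3 : ℝ) / 2 + B - 2) (by linarith)
  refine IntegrableOn.congr_fun ((h1.add h2).const_mul (2 ^ B / 4)) (fun u hu => ?_)
    measurableSet_Ioi
  have hu : 0 < u := hu
  have he : -(t ^ 2 / 4) / u = -(t ^ 2) / (4 * u) := by field_simp
  simp only [Pi.add_apply]
  rw [he, Real.rpow_sub hu, Real.rpow_sub hu, Real.rpow_add hu, Real.rpow_one,
    Real.rpow_two, Real.mul_rpow (by norm_num) hu.le]
  field_simp

theorem abs_integral_sub_integral_le {X : Type*} [MeasurableSpace X] {μ : Measure X}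
    {F G h : X → ℝ} (hF : AEStronglyMeasurable F μ) (hG : AEStronglyMeasurable G μ)
    (hh : Integrable h μ) (hb : ∀ᵐ a ∂μ, |F a - G a| ≤ h a) :
    |∫ a, F a ∂μ - ∫ a, G a ∂μ| ≤ ∫ a, h a ∂μ := by
  have hFG : Integrable (F - G) μ := hh.mono' (hF.sub hG) hb
  by_cases hFi : Integrable F μ
  · have hGi : Integrable G μ := by simpa using hFi.sub hFG
    rw [← integral_sub hFi hGi]
    exact norm_integral_le_of_norm_le (f := F - G) hh hb
  · have hGi : ¬ Integrable G μ := fun hGi => hFi (by simpa using hFG.add hGi)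
    rw [integral_undef hFi, integral_undef hGi, sub_zero, abs_zero]
    exact integral_nonneg_of_ae (hb.mono fun a ha => (abs_nonneg _).trans ha)

theorem poissonK_eq {d : ℕ} (α : Fin d → ℝ) (t : ℝ) {x y : Fin d → ℝ}
    (hx : x ∈ posOrth d) (hy : y ∈ posOrth d) :
    poissonK d α t x y = (t / Real.sqrt (2 * Real.pi)) * ∫ u in Ioi (0 : ℝ),
      u ^ (-(3 : ℝ) / 2) * Real.exp (-(t ^ 2) / (4 * u)) * heatProd d α u x y := by
  rw [poissonK]
  congr 1
  refine setIntegral_congr_fun measurableSet_Ioi fun u hu => ?_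
  simp only [heatK_eq_heatProd α hu hx hy]

theorem update_mem_posOrth {d : ℕ} {i : Fin d} {x : Fin d → ℝ} (hx : ∀ j, j ≠ i → 0 < x j)
    {r : ℝ} (hr : 0 < r) : Function.update x i r ∈ posOrth d := by
  intro j
  by_cases h : j = i
  · subst h
    simpa using hr
  · simpa [h] using hx j h

theorem measurable_subordinated {d : ℕ} {α : Fin d → ℝ} (hα : ∀ j, 0 ≤ α j) (t : ℝ)
    (x : Fin d → ℝ) :
    Measurable fun p : (Fin d → ℝ) × ℝ =>
      p.2 ^ (-(3 : ℝ) / 2) * Real.exp (-(t ^ 2) / (4 * p.2)) * heatProd d α p.2 x p.1 :=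
  Measurable.mul (by fun_prop) (measurable_heatProd hα x)

theorem exists_abs_poissonK_sub_le {d : ℕ} {α : Fin d → ℝ} (hα : ∀ j, 0 ≤ α j) {t : ℝ}
    (ht : 0 < t) (i : Fin d) {x : Fin d → ℝ} (hx : ∀ j, j ≠ i → 0 < x j) :
    ∃ L : ℝ, ∀ r s : ℝ, 0 < r → 0 < s → ∀ y ∈ posOrth d,
      |poissonK d α t (Function.update x i r) y - poissonK d α t (Function.update x i s) y| ≤
        L * |r ^ 2 - s ^ 2| * (1 + y i ^ 2) := by
  set B := -(∑ j, α j) - (d : ℝ) / 2 with hB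
  have hB0 : B ≤ 0 := by
    have : 0 ≤ ∑ j, α j := Finset.sum_nonneg fun j _ => hα j
    have : (0 : ℝ) ≤ d := Nat.cast_nonneg d
    linarith
  have hw := integrableOn_subordinationWeight ht hB0
  refine ⟨(t / Real.sqrt (2 * Real.pi)) * ((∏ j, besselCoeff (α j - 1 / 2) 0) *
    ∫ u in Ioi (0 : ℝ), u ^ (-(3 : ℝ) / 2) * Real.exp (-(t ^ 2) / (4 * u)) *
      ((2 * u) ^ B * (1 / (4 * u) + 1 / (4 * u ^ 2)))), fun r s hr hs y hy => ?_⟩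
  rw [poissonK_eq α t (update_mem_posOrth hx hr) hy, poissonK_eq α t (update_mem_posOrth hx hs) hy,
    ← mul_sub, abs_mul, abs_of_nonneg (by positivity : 0 ≤ t / Real.sqrt (2 * Real.pi))]
  have hm : ∀ q : ℝ, AEStronglyMeasurable (fun u : ℝ => u ^ (-(3 : ℝ) / 2) *
      Real.exp (-(t ^ 2) / (4 * u)) * heatProd d α u (Function.update x i q) y)
      (volume.restrict (Ioi 0)) := fun q =>
    ((measurable_subordinated hα t (Function.update x i q)).comp
      measurable_prodMk_left).aestronglyMeasurable
  have key := abs_integral_sub_integral_le (hm r) (hm s)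
    (hw.const_mul ((∏ j, besselCoeff (α j - 1 / 2) 0) * |r ^ 2 - s ^ 2| * (1 + y i ^ 2))) (by
      filter_upwards [ae_restrict_mem measurableSet_Ioi] with u hu
      have hu : 0 < u := hu
      have he : 0 ≤ u ^ (-(3 : ℝ) / 2) * Real.exp (-(t ^ 2) / (4 * u)) := by positivity
      rw [← mul_sub, abs_mul, abs_of_nonneg he, mul_left_comm]
      exact mul_le_mul_of_nonneg_left (abs_heatProd_update_sub_le hα hu i hx hy hr hs) he)
  rw [integral_const_mul] at key
  refine (mul_le_mul_of_nonneg_left key (by positivity)).trans (le_of_eq ?_)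
  ring

theorem measurableSet_posOrth (d : ℕ) : MeasurableSet (posOrth d) := by
  have : posOrth d = Set.pi Set.univ fun _ => Ioi 0 := by
    ext x
    simp [posOrth]
  rw [this]
  exact MeasurableSet.univ_pi fun _ => measurableSet_Ioi

theorem ae_mem_posOrth (d : ℕ) (α : Fin d → ℝ) : ∀ᵐ y ∂(wMeasure d α), y ∈ posOrth d :=
  (withDensity_absolutelyContinuous _ _).ae_le (ae_restrict_mem (measurableSet_posOrth d))

theorem isLocallyFiniteMeasure_wMeasure {d : ℕ} {α : Fin d → ℝ} (hα : ∀ j, 0 ≤ α j) :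
    IsLocallyFiniteMeasure (wMeasure d α) :=
  IsLocallyFiniteMeasure.withDensity_ofReal <| continuous_finsetProd _ fun j _ =>
    (continuous_apply j).rpow_const fun _ => Or.inr (by linarith [hα j])

theorem exists_abs_poissonOp_sub_le {d : ℕ} {α : Fin d → ℝ} (hα : ∀ j, 0 ≤ α j)
    {f : (Fin d → ℝ) → ℝ} (hf : CcInfPos d f) {t : ℝ} (ht : 0 < t) (i : Fin d)
    {x : Fin d → ℝ} (hx : ∀ j, j ≠ i → 0 < x j) :
    ∃ L : ℝ, ∀ r s : ℝ, 0 < r → 0 < s →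
      |poissonOp d α t f (Function.update x i r) - poissonOp d α t f (Function.update x i s)| ≤
        L * |r ^ 2 - s ^ 2| := by
  obtain ⟨L, hL⟩ := exists_abs_poissonK_sub_le hα ht i hx
  have := isLocallyFiniteMeasure_wMeasure hα
  have hfc : Continuous f := hf.1.continuous
  have hh : Integrable (fun y => (1 + y i ^ 2) * |f y|) (wMeasure d α) :=
    Continuous.integrable_of_hasCompactSupport (by fun_prop)
      (HasCompactSupport.mul_left (f := fun y : Fin d → ℝ => 1 + y i ^ 2) hf.2.1.norm)
  have hm : ∀ r : ℝ, 0 < r → AEStronglyMeasurable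
      (fun y => poissonK d α t (Function.update x i r) y * f y) (wMeasure d α) := by
    intro r hr
    have hK : StronglyMeasurable fun y : Fin d → ℝ => ∫ u in Ioi (0 : ℝ),
        u ^ (-(3 : ℝ) / 2) * Real.exp (-(t ^ 2) / (4 * u)) *
          heatProd d α u (Function.update x i r) y :=
      (measurable_subordinated hα t (Function.update x i r)).stronglyMeasurable.integral_prod_right'
    refine ((hK.const_mul (t / Real.sqrt (2 * Real.pi))).mul
      hfc.stronglyMeasurable).aestronglyMeasurable.congr ?_
    filter_upwards [ae_mem_posOrth d α] with y hy
    rw [poissonK_eq α t (update_mem_posOrth hx hr) hy]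
    rfl
  refine ⟨L * ∫ y, (1 + y i ^ 2) * |f y| ∂(wMeasure d α), fun r s hr hs => ?_⟩
  have key := abs_integral_sub_integral_le (hm r hr) (hm s hs)
    (hh.const_mul (L * |r ^ 2 - s ^ 2|)) (by
      filter_upwards [ae_mem_posOrth d α] with y hy
      rw [← sub_mul, abs_mul, ← mul_assoc]
      exact mul_le_mul_of_nonneg_right (hL r s hr hs y hy) (abs_nonneg _))
  rw [integral_const_mul] at key
  refine key.trans (le_of_eq ?_)
  ring

/-- The derivative at `s > 0` of a function that is Lipschitz in the square of its variable is at
most a constant times `s`, whether or not the function is differentiable there. -/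
theorem abs_deriv_le_of_lipschitz_sq {G : ℝ → ℝ} {L : ℝ}
    (hG : ∀ r s : ℝ, 0 < r → 0 < s → |G r - G s| ≤ L * |r ^ 2 - s ^ 2|) {s : ℝ} (hs : 0 < s) :
    |deriv G s| ≤ |L| * (3 * s) := by
  refine norm_deriv_le_of_lip' (f := G) (by positivity) ?_
  filter_upwards [Ioo_mem_nhds hs (show s < 2 * s by linarith)] with r hr
  have hrs : |r ^ 2 - s ^ 2| ≤ 3 * s * |r - s| := by
    rw [sq_sub_sq, abs_mul, abs_of_pos (by linarith [hr.1] : 0 < r + s)]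
    exact mul_le_mul_of_nonneg_right (by linarith [hr.2]) (abs_nonneg _)
  calc |G r - G s| ≤ L * |r ^ 2 - s ^ 2| := hG r s hr.1 hs
    _ ≤ |L| * (3 * s * |r - s|) :=
      mul_le_mul (le_abs_self L) hrs (abs_nonneg _) (abs_nonneg L)
    _ = _ := by rw [← mul_assoc, Real.norm_eq_abs]

/-- The `i`-th partial derivative of the Poisson integral tends to `0` as the
`i`-th variable tends to `0⁺`, the other coordinates being fixed and positive. -/
theorem poisson_pd_tendsto_zero_boundary (d : ℕ) (α : Fin d → ℝ)
    (hα : ∀ j, 0 ≤ α j) (f : (Fin d → ℝ) → ℝ) (hf : CcInfPos d f)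
    (i : Fin d) (t : ℝ) (ht : 0 < t)
    (x : Fin d → ℝ) (hx : ∀ j, j ≠ i → 0 < x j) :
    Tendsto (fun s => pd d i (poissonOp d α t f) (Function.update x i s))
      (nhdsWithin 0 (Set.Ioi 0)) (nhds 0) := by
  obtain ⟨L, hL⟩ := exists_abs_poissonOp_sub_le hα hf ht i hx
  have h0 : Tendsto (fun s : ℝ => |L| * (3 * s)) (nhdsWithin 0 (Set.Ioi 0)) (nhds 0) := by
    have h : Continuous fun s : ℝ => |L| * (3 * s) := by fun_prop
    simpa using (h.tendsto 0).mono_left nhdsWithin_le_nhds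
  refine squeeze_zero_norm' ?_ h0
  filter_upwards [self_mem_nhdsWithin] with s hs
  simp only [pd, Function.update_idem, Function.update_self]
  exact abs_deriv_le_of_lipschitz_sq hL hs
end
end

section
/- Let α ∈ [0,∞)^d. There exists a constant C > 0, depending only on α and d, such that for every x, y ∈ ℝ_+^d and every t > 0, the Bessel–Poisson kernel satisfies 0 ≤ 𝒫_t^α(x,y) ≤ C t / (t² + |x−y|²)^{|α| + (d+1)/2}. -/
open MeasureTheory Real Filter Set
open scoped ENNReal BigOperators

noncomputable section

lemma factorial_two_mul_mul_Gamma_le {a : ℝ} (ha : 0 ≤ a) (k : ℕ) :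
    ((2 * k).factorial : ℝ) * Real.Gamma (a + 1 / 2) ≤
      (k.factorial : ℝ) * 2 ^ (2 * k) * Real.Gamma ((k : ℝ) + (a - 1 / 2) + 1) := by
  induction k with
  | zero =>
    rw [Nat.cast_zero, show (0 : ℝ) + (a - 1 / 2) + 1 = a + 1 / 2 by ring]
    simp
  | succ k ih =>
    have hk : (0 : ℝ) ≤ k := k.cast_nonneg
    have hG : Real.Gamma (((k + 1 : ℕ) : ℝ) + (a - 1 / 2) + 1) =
        (k + a + 1 / 2) * Real.Gamma ((k : ℝ) + (a - 1 / 2) + 1) := by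
      rw [← show (k : ℝ) + (a - 1 / 2) + 1 = k + a + 1 / 2 by ring,
        ← Real.Gamma_add_one (by linarith)]
      congr 1
      push_cast
      ring
    have hpos : 0 < Real.Gamma ((k : ℝ) + (a - 1 / 2) + 1) := Real.Gamma_pos_of_pos (by linarith)
    rw [hG, show 2 * (k + 1) = 2 * k + 1 + 1 by ring, Nat.factorial_succ (2 * k + 1),
      Nat.factorial_succ (2 * k), Nat.factorial_succ k]
    push_cast
    calc _ = (2 * k + 1 + 1) * (2 * k + 1) * (((2 * k).factorial : ℝ) * Real.Gamma (a + 1 / 2)) := by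
          ring
      _ ≤ (2 * k + 1 + 1) * (2 * a + 2 * k + 1) *
          ((k.factorial : ℝ) * 2 ^ (2 * k) * Real.Gamma ((k : ℝ) + (a - 1 / 2) + 1)) := by
          gcongr ?_ * (?_ + 1) * ?_
          linarith
      _ = _ := by ring

lemma besselI_nonneg {μ z : ℝ} (hμ : -1 < μ) (hz : 0 ≤ z) : 0 ≤ besselI μ z := by
  refine tsum_nonneg fun k => ?_
  have hG : 0 < Real.Gamma ((k : ℝ) + μ + 1) :=
    Real.Gamma_pos_of_pos (by linarith [k.cast_nonneg (α := ℝ)])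
  positivity

lemma rpow_mul_besselI_le {a z : ℝ} (ha : 0 ≤ a) (hz : 0 < z) :
    z ^ (-a + 1 / 2) * besselI (a - 1 / 2) z ≤
      2 ^ (-a + 1 / 2) / Real.Gamma (a + 1 / 2) * Real.exp z := by
  have hGa : 0 < Real.Gamma (a + 1 / 2) := Real.Gamma_pos_of_pos (by linarith)
  have hG (k : ℕ) : 0 < Real.Gamma ((k : ℝ) + (a - 1 / 2) + 1) :=
    Real.Gamma_pos_of_pos (by linarith [k.cast_nonneg (α := ℝ)])
  have hcosh := (Real.hasSum_cosh z).mul_left ((2 : ℝ) ^ (-a + 1 / 2) / Real.Gamma (a + 1 / 2))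
  have hpow (k : ℕ) : z ^ (-a + 1 / 2) * (z / 2) ^ (2 * (k : ℝ) + (a - 1 / 2)) =
      2 ^ (-a + 1 / 2) * z ^ (2 * k) / 2 ^ (2 * k) := by
    rw [show 2 * (k : ℝ) + (a - 1 / 2) = 2 * k + -(-a + 1 / 2) by ring,
      Real.rpow_add (div_pos hz two_pos), Real.rpow_neg (by positivity), Real.div_rpow hz.le zero_le_two (-a + 1 / 2),
      show 2 * (k : ℝ) = ((2 * k : ℕ) : ℝ) by push_cast; ring, Real.rpow_natCast, div_pow]
    have h1 : 0 < z ^ (-a + 1 / 2) := by positivity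
    field_simp
  have hle (k : ℕ) :
      z ^ (-a + 1 / 2) * (1 / ((k.factorial : ℝ) * Real.Gamma ((k : ℝ) + (a - 1 / 2) + 1)) *
        (z / 2) ^ (2 * (k : ℝ) + (a - 1 / 2))) ≤
      2 ^ (-a + 1 / 2) / Real.Gamma (a + 1 / 2) * (z ^ (2 * k) / ((2 * k).factorial : ℝ)) := by
    have := hG k
    calc _ = 2 ^ (-a + 1 / 2) * z ^ (2 * k) /
          ((k.factorial : ℝ) * 2 ^ (2 * k) * Real.Gamma ((k : ℝ) + (a - 1 / 2) + 1)) := by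
          rw [mul_left_comm, hpow]
          field_simp
      _ ≤ 2 ^ (-a + 1 / 2) * z ^ (2 * k) /
          (((2 * k).factorial : ℝ) * Real.Gamma (a + 1 / 2)) := by
          refine div_le_div_of_nonneg_left (by positivity) (by positivity) ?_
          exact factorial_two_mul_mul_Gamma_le ha k
      _ = _ := by field_simp
  have hsum : Summable fun k : ℕ => z ^ (-a + 1 / 2) *
      (1 / ((k.factorial : ℝ) * Real.Gamma ((k : ℝ) + (a - 1 / 2) + 1)) *
        (z / 2) ^ (2 * (k : ℝ) + (a - 1 / 2))) :=
    hcosh.summable.of_nonneg_of_le (fun k => by have := hG k; positivity) hle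
  rw [besselI, ← tsum_mul_left]
  calc _ ≤ 2 ^ (-a + 1 / 2) / Real.Gamma (a + 1 / 2) * Real.cosh z :=
        hasSum_le hle hsum.hasSum hcosh
    _ ≤ _ := by
        gcongr
        rw [Real.cosh_eq]
        linarith [Real.exp_le_exp.2 (show -z ≤ z by linarith)]

lemma heatK_nonneg {d : ℕ} {α : Fin d → ℝ} (hα : ∀ j, 0 ≤ α j) {x y : Fin d → ℝ}
    (hx : x ∈ posOrth d) (hy : y ∈ posOrth d) {u : ℝ} (hu : 0 < u) :
    0 ≤ heatK d α u x y := by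
  refine mul_nonneg (by positivity) (Finset.prod_nonneg fun j _ => ?_)
  have hz : 0 ≤ x j * y j / (2 * u) := by
    have := hx j
    have := hy j
    positivity
  exact mul_nonneg (by positivity) (besselI_nonneg (by linarith [hα j]) hz)

lemma heatK_le {d : ℕ} {α : Fin d → ℝ} (hα : ∀ j, 0 ≤ α j) {x y : Fin d → ℝ}
    (hx : x ∈ posOrth d) (hy : y ∈ posOrth d) {u : ℝ} (hu : 0 < u) :
    heatK d α u x y ≤ (∏ j, (2 : ℝ) ^ (-(α j) + 1 / 2) / Real.Gamma (α j + 1 / 2)) *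
      ((2 * u) ^ (-(∑ j, α j) - (d : ℝ) / 2) *
        Real.exp (-(∑ j, (x j - y j) ^ 2) / (4 * u))) := by
  have hz (j) : 0 < x j * y j / (2 * u) := by
    have := hx j
    have := hy j
    positivity
  have hprod : ∏ j, ((x j * y j / (2 * u)) ^ (-(α j) + 1 / 2) *
        besselI (α j - 1 / 2) (x j * y j / (2 * u))) ≤
      (∏ j, (2 : ℝ) ^ (-(α j) + 1 / 2) / Real.Gamma (α j + 1 / 2)) *
        Real.exp (∑ j, x j * y j / (2 * u)) := by
    rw [Real.exp_sum, ← Finset.prod_mul_distrib]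
    refine Finset.prod_le_prod (fun j _ => ?_) fun j _ => rpow_mul_besselI_le (hα j) (hz j)
    exact mul_nonneg (Real.rpow_nonneg (hz j).le _)
      (besselI_nonneg (by linarith [hα j]) (hz j).le)
  have hexp : Real.exp (-(∑ j, (x j - y j) ^ 2) / (4 * u)) =
      Real.exp (-((eNorm d x) ^ 2 + (eNorm d y) ^ 2) / (4 * u)) *
        Real.exp (∑ j, x j * y j / (2 * u)) := by
    rw [← Real.exp_add, eNorm, eNorm, Real.sq_sqrt (by positivity), Real.sq_sqrt (by positivity),
      ← Finset.sum_add_distrib, ← Finset.sum_neg_distrib, ← Finset.sum_neg_distrib,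
      Finset.sum_div, Finset.sum_div, ← Finset.sum_add_distrib]
    congr 1
    refine Finset.sum_congr rfl fun j _ => ?_
    field_simp
    ring
  rw [heatK, hexp]
  calc _ ≤ (2 * u) ^ (-(∑ j, α j) - (d : ℝ) / 2) *
        Real.exp (-((eNorm d x) ^ 2 + (eNorm d y) ^ 2) / (4 * u)) *
        ((∏ j, (2 : ℝ) ^ (-(α j) + 1 / 2) / Real.Gamma (α j + 1 / 2)) *
          Real.exp (∑ j, x j * y j / (2 * u))) := by gcongr
    _ = _ := by ring

lemma abs_mul_rpow_smul_comp_rpow_neg_one {s b u : ℝ} (hu : 0 < u) :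
    (|(-1 : ℝ)| * u ^ ((-1 : ℝ) - 1)) • ((u ^ (-1 : ℝ)) ^ (s - 1) * Real.exp (-(b * u ^ (-1 : ℝ)))) =
      u ^ (-s - 1) * Real.exp (-b / u) := by
  rw [smul_eq_mul, ← Real.rpow_mul hu.le, abs_neg, abs_one, one_mul, ← mul_assoc,
    ← Real.rpow_add hu, Real.rpow_neg_one]
  ring_nf

lemma integrableOn_rpow_mul_exp_neg_div_Ioi {s b : ℝ} (hs : 0 < s) (hb : 0 < b) :
    IntegrableOn (fun u : ℝ => u ^ (-s - 1) * Real.exp (-b / u)) (Ioi 0) := by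
  have h : IntegrableOn (fun v : ℝ => v ^ (s - 1) * Real.exp (-(b * v))) (Ioi 0) := by
    simpa using integrableOn_rpow_mul_exp_neg_mul_rpow (p := 1) (s := s - 1) (by linarith) one_pos hb
  rw [← integrableOn_Ioi_comp_rpow_iff _ (p := -1) (by norm_num)] at h
  exact h.congr_fun (fun u hu => abs_mul_rpow_smul_comp_rpow_neg_one hu) measurableSet_Ioi

lemma integral_rpow_mul_exp_neg_div_Ioi {s b : ℝ} (hs : 0 < s) (hb : 0 < b) :
    ∫ u in Ioi (0 : ℝ), u ^ (-s - 1) * Real.exp (-b / u) = (1 / b) ^ s * Real.Gamma s := by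
  rw [← Real.integral_rpow_mul_exp_neg_mul_Ioi hs hb,
    ← integral_comp_rpow_Ioi (fun v : ℝ => v ^ (s - 1) * Real.exp (-(b * v))) (p := -1)
      (by norm_num)]
  exact setIntegral_congr_fun measurableSet_Ioi fun u hu => (abs_mul_rpow_smul_comp_rpow_neg_one hu).symm

/-- Size estimate for the Bessel–Poisson kernel. -/
theorem poisson_kernel_estimate (d : ℕ) (α : Fin d → ℝ) (hα : ∀ j, 0 ≤ α j) :
    ∃ C > (0 : ℝ), ∀ x ∈ posOrth d, ∀ y ∈ posOrth d, ∀ t > (0 : ℝ),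
      0 ≤ poissonK d α t x y ∧
      poissonK d α t x y ≤
        C * t / (t ^ 2 + ∑ j, (x j - y j) ^ 2) ^
          ((∑ j, α j) + ((d : ℝ) + 1) / 2) := by
  set s : ℝ := (∑ j, α j) + ((d : ℝ) + 1) / 2 with hs_def
  have hs : 0 < s := by
    have : 0 ≤ ∑ j, α j := Finset.sum_nonneg fun j _ => hα j
    positivity
  set K : ℝ := ∏ j, (2 : ℝ) ^ (-(α j) + 1 / 2) / Real.Gamma (α j + 1 / 2)
  have hK : 0 < K := Finset.prod_pos fun j _ =>
    div_pos (by positivity) (Real.Gamma_pos_of_pos (by linarith [hα j]))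
  have hGs : 0 < Real.Gamma s := Real.Gamma_pos_of_pos hs
  set m : ℝ := -(∑ j, α j) - (d : ℝ) / 2 with hm_def
  refine ⟨1 / Real.sqrt (2 * Real.pi) * (K * 2 ^ m * (4 ^ s * Real.Gamma s)), by positivity, ?_⟩
  intro x hx y hy t ht
  have hnonneg : ∀ u ∈ Ioi (0 : ℝ),
      0 ≤ u ^ (-(3 : ℝ) / 2) * Real.exp (-(t ^ 2) / (4 * u)) * heatK d α u x y := fun u hu =>
    mul_nonneg (mul_nonneg (Real.rpow_nonneg (le_of_lt hu) _) (Real.exp_pos _).le)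
      (heatK_nonneg hα hx hy hu)
  refine ⟨mul_nonneg (by positivity) (setIntegral_nonneg measurableSet_Ioi hnonneg), ?_⟩
  set A : ℝ := t ^ 2 + ∑ j, (x j - y j) ^ 2 with hA_def
  have hA : 0 < A := by positivity
  have hle : ∀ u ∈ Ioi (0 : ℝ),
      u ^ (-(3 : ℝ) / 2) * Real.exp (-(t ^ 2) / (4 * u)) * heatK d α u x y ≤
        K * 2 ^ m * (u ^ (-s - 1) * Real.exp (-(A / 4) / u)) := by
    intro u (hu : 0 < u)
    calc _ ≤ u ^ (-(3 : ℝ) / 2) * Real.exp (-(t ^ 2) / (4 * u)) *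
          (K * ((2 * u) ^ m * Real.exp (-(∑ j, (x j - y j) ^ 2) / (4 * u)))) := by
          gcongr
          exact heatK_le hα hx hy hu
      _ = _ := by
          rw [Real.mul_rpow zero_le_two hu.le,
            show -s - 1 = -(3 : ℝ) / 2 + m by rw [hs_def, hm_def]; ring, Real.rpow_add hu,
            show -(A / 4) / u = -(t ^ 2) / (4 * u) + -(∑ j, (x j - y j) ^ 2) / (4 * u) by
              rw [hA_def]; field_simp; ring, Real.exp_add]
          ring
  have hint : ∫ u in Ioi (0 : ℝ),
      u ^ (-(3 : ℝ) / 2) * Real.exp (-(t ^ 2) / (4 * u)) * heatK d α u x y ≤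
        K * 2 ^ m * ((1 / (A / 4)) ^ s * Real.Gamma s) := by
    rw [← integral_rpow_mul_exp_neg_div_Ioi hs (by positivity : 0 < A / 4), ← integral_const_mul]
    exact integral_mono_of_nonneg (ae_restrict_of_forall_mem measurableSet_Ioi hnonneg)
      ((integrableOn_rpow_mul_exp_neg_div_Ioi hs (by positivity)).const_mul _)
      (ae_restrict_of_forall_mem measurableSet_Ioi hle)
  rw [poissonK]
  calc _ ≤ t / Real.sqrt (2 * Real.pi) * (K * 2 ^ m * ((1 / (A / 4)) ^ s * Real.Gamma s)) := by
        gcongr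
    _ = _ := by
        rw [one_div_div, Real.div_rpow (by norm_num) hA.le]
        ring
end
end
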